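/- arXiv:2410.03363 — 4 statements merged into one kernel-verified Lean document; each statement's English description precedes it below -/
import Mathlib

section
/- Under the online chaining-tree protocol with the parameter-free grad-step assumption, suppose T = 2^{dH} (i.e. H = (1/d)·log₂T). Then for every L > 0, every α ∈ (0,1] and every f in the Hölder class 𝒞^α(𝒳,L), the regret satisfies Σ_{t=1}^T ℓ_t(f̂_t(x_t)) − Σ_{t=1}^T ℓ_t(f(x_t)) ≤ G·B·(C₁√T + C₂) + G·L·D^α·R, where, with Φ(u) = |2^u − 1|^{−1}: R = (Φ(d/2 − α)·C₁ + 4C₂ + 1)·√T if d < 2α; R = ((C₁/d)·log₂T + 4C₂ + 1)·√T if d = 2α; and R = (Φ(d/2 − α)·C₁ + 4C₂ + 1)·T^{1−α/d} if d > 2α. -/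
open Finset

noncomputable section

/-- The dyadic index set at level `m`: functions `Fin d → ℕ` with each coordinate
below `2^(m-1)`. -/
def Jset (d m : ℕ) : Finset (Fin d → ℕ) :=
  Fintype.piFinset fun _ => Finset.range (2 ^ (m - 1))

/-- Real-valued indicator of a set. -/
def indR {α : Type*} (s : Set α) (x : α) : ℝ := Set.indicator s (fun _ => (1 : ℝ)) x

/-- A dyadic chaining-tree structure of depth `H` on `X ⊆ ℝ^d` with diameter bound `D`. -/
structure DyadicTree (d : ℕ) (X : Set (Fin d → ℝ)) (D : ℝ) (H : ℕ) where
  cell : ℕ → (Fin d → ℕ) → Set (Fin d → ℝ)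
  pt : ℕ → (Fin d → ℕ) → (Fin d → ℝ)
  root_eq : cell 1 0 = X
  child_sub : ∀ m : ℕ, 1 ≤ m → m < H → ∀ j' ∈ Jset d (m + 1),
    cell (m + 1) j' ⊆ cell m (fun i => j' i / 2)
  partition : ∀ m : ℕ, 1 ≤ m → m < H → ∀ j ∈ Jset d m, ∀ x ∈ cell m j,
    ∃! j' : Fin d → ℕ,
      j' ∈ Jset d (m + 1) ∧ (∀ i, j' i / 2 = j i) ∧ x ∈ cell (m + 1) j'
  pt_dist : ∀ m ∈ Finset.Icc 1 H, ∀ j ∈ Jset d m, ∀ x ∈ cell m j,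
    ‖x - pt m j‖ ≤ (2 : ℝ) ^ (-(m : ℝ)) * D
  parent_dist : ∀ m : ℕ, 1 ≤ m → m < H → ∀ j' ∈ Jset d (m + 1),
    ‖pt (m + 1) j' - pt m (fun i => j' i / 2)‖ ≤ (2 : ℝ) ^ (-((m : ℝ) + 1)) * D

/-- `Φ(u) = |2^u − 1|⁻¹`. -/
def Phi (u : ℝ) : ℝ := |(2 : ℝ) ^ u - 1|⁻¹

namespace DyadicTree

lemma half_mem_Jset {d m : ℕ} (hm : 1 ≤ m) {j : Fin d → ℕ} (hj : j ∈ Jset d (m + 1)) :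
    (fun i => j i / 2) ∈ Jset d m := by
  simp only [Jset, Fintype.mem_piFinset, Finset.mem_range, Nat.add_sub_cancel] at hj ⊢
  intro i
  obtain ⟨k, rfl⟩ : ∃ k, m = k + 1 := ⟨m - 1, by omega⟩
  have := hj i
  rw [pow_succ] at this
  simp only [Nat.add_sub_cancel]
  omega

lemma Jset_one (d : ℕ) : Jset d 1 = {0} := by
  ext j
  simp [Jset, funext_iff]

lemma card_Jset (d m : ℕ) : (Jset d m).card = 2 ^ (d * (m - 1)) := by
  simp [Jset, ← pow_mul, mul_comm]

lemma sum_mul_indR_eq {ι β : Type*} {s : Finset ι} {A : ι → Set β} {y : β} {j : ι} (hj : j ∈ s)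
    (hy : y ∈ A j) (huniq : ∀ i ∈ s, y ∈ A i → i = j) (c : ι → ℝ) :
    ∑ i ∈ s, c i * indR (A i) y = c j := by
  rw [Finset.sum_eq_single_of_mem j hj]
  · simp [indR, hy]
  · intro i hi hij
    have : y ∉ A i := fun h => hij (huniq i hi h)
    simp [indR, this]

variable {d H : ℕ} {X : Set (Fin d → ℝ)} {D : ℝ}

lemma cell_subset (tree : DyadicTree d X D H) {m : ℕ} (hm : 1 ≤ m) :
    m ≤ H → ∀ j ∈ Jset d m, tree.cell m j ⊆ X := by
  induction m, hm using Nat.le_induction with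
  | base =>
    intro _ j hj
    rw [Jset_one, Finset.mem_singleton] at hj
    rw [hj, tree.root_eq]
  | succ m hm ih =>
    intro hmH j hj
    exact (tree.child_sub m hm hmH j hj).trans (ih (by omega) _ (half_mem_Jset hm hj))

lemma existsUnique_cell (tree : DyadicTree d X D H) {y : Fin d → ℝ} (hy : y ∈ X) {m : ℕ}
    (hm : 1 ≤ m) : m ≤ H → ∃! j, j ∈ Jset d m ∧ y ∈ tree.cell m j := by
  induction m, hm using Nat.le_induction with
  | base =>
    intro _
    refine ⟨0, ⟨by simp [Jset_one], by rwa [tree.root_eq]⟩, ?_⟩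
    rintro j ⟨hj, -⟩
    simpa [Jset_one] using hj
  | succ m hm ih =>
    intro hmH
    obtain ⟨j, ⟨hj, hyj⟩, huniq⟩ := ih (by omega)
    obtain ⟨j', ⟨hj', -, hyj'⟩, huniq'⟩ := tree.partition m hm hmH j hj y hyj
    refine ⟨j', ⟨hj', hyj'⟩, ?_⟩
    rintro i ⟨hi, hyi⟩
    have hpar := huniq _ ⟨half_mem_Jset hm hi, tree.child_sub m hm hmH i hi hyi⟩
    exact huniq' i ⟨hi, fun k => congrFun hpar k, hyi⟩

/-- The increment of `f` from the point of the parent to the point of the node `(m, j)`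
(the value of `f` itself at the root). -/
def increment (tree : DyadicTree d X D H) (f : (Fin d → ℝ) → ℝ) (m : ℕ) (j : Fin d → ℕ) : ℝ :=
  if m = 1 then f (tree.pt 1 j) else f (tree.pt m j) - f (tree.pt (m - 1) fun i => j i / 2)

/-- The increments along the branch of `y` telescope to the value of `f` at the last point. -/
lemma exists_sum_increment_eq (tree : DyadicTree d X D H) (f : (Fin d → ℝ) → ℝ)
    {y : Fin d → ℝ} (hy : y ∈ X) {n : ℕ} (hn : 1 ≤ n) :
    n ≤ H → ∃ j ∈ Jset d n, y ∈ tree.cell n j ∧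
      ∑ m ∈ Finset.Icc 1 n, ∑ i ∈ Jset d m, tree.increment f m i * indR (tree.cell m i) y
        = f (tree.pt n j) := by
  induction n, hn using Nat.le_induction with
  | base =>
    intro _
    have h0 : y ∈ tree.cell 1 0 := by rwa [tree.root_eq]
    refine ⟨0, by simp [Jset_one], h0, ?_⟩
    simp [Jset_one, increment, indR, h0]
  | succ n hn ih =>
    intro hnH
    obtain ⟨j, hj, hyj, hsum⟩ := ih (by omega)
    obtain ⟨j', ⟨hj', hyj'⟩, huniq'⟩ := tree.existsUnique_cell hy (Nat.succ_pos n) hnH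
    refine ⟨j', hj', hyj', ?_⟩
    have hpar : (fun i => j' i / 2) = j :=
      (tree.existsUnique_cell hy hn (by omega)).unique
        ⟨half_mem_Jset hn hj', tree.child_sub n hn hnH j' hj' hyj'⟩ ⟨hj, hyj⟩
    rw [Finset.sum_Icc_succ_top (by omega), hsum,
      sum_mul_indR_eq hj' hyj' fun i hi hyi => huniq' i ⟨hi, hyi⟩, increment,
      if_neg (by omega), Nat.add_sub_cancel, hpar]
    ring

/-- Cauchy–Schwarz over the cells of one level. -/
lemma sum_sqrt_le (tree : DyadicTree d X D H) {m : ℕ} (hm : 1 ≤ m) (hmH : m ≤ H)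
    {x : ℕ → (Fin d → ℝ)} (hx : ∀ t, x t ∈ X) {g : ℕ → ℝ} {G : ℝ} (hG : 0 ≤ G)
    (hg : ∀ t, |g t| ≤ G) (T : ℕ) :
    ∑ j ∈ Jset d m, √(∑ t ∈ Finset.range T, (g t * indR (tree.cell m j) (x t)) ^ 2)
      ≤ √((2 : ℝ) ^ (d * (m - 1))) * (G * √T) := by
  have hsum : ∑ j ∈ Jset d m, ∑ t ∈ Finset.range T, (g t * indR (tree.cell m j) (x t)) ^ 2
      ≤ G ^ 2 * T := by
    rw [Finset.sum_comm]
    have hle : ∀ t ∈ Finset.range T,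
        ∑ j ∈ Jset d m, (g t * indR (tree.cell m j) (x t)) ^ 2 ≤ G ^ 2 := by
      intro t _
      obtain ⟨j, ⟨hj, hxj⟩, huniq⟩ := tree.existsUnique_cell (hx t) hm hmH
      have hsq : ∀ i, (g t * indR (tree.cell m i) (x t)) ^ 2
          = g t ^ 2 * indR (tree.cell m i) (x t) := by
        intro i
        by_cases h : x t ∈ tree.cell m i <;> simp [indR, h]
      simp_rw [hsq]
      rw [sum_mul_indR_eq hj hxj (fun i hi hxi => huniq i ⟨hi, hxi⟩) fun _ => g t ^ 2]
      exact sq_le_sq' (by linarith [neg_abs_le (g t), hg t]) ((le_abs_self _).trans (hg t))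
    calc _ ≤ ∑ t ∈ Finset.range T, G ^ 2 := Finset.sum_le_sum hle
      _ = G ^ 2 * T := by simp [mul_comm]
  have hcs := sq_sum_le_card_mul_sum_sq (s := Jset d m)
    (f := fun j => √(∑ t ∈ Finset.range T, (g t * indR (tree.cell m j) (x t)) ^ 2))
  simp_rw [Real.sq_sqrt (Finset.sum_nonneg fun t _ => sq_nonneg _), card_Jset] at hcs
  refine (Real.le_sqrt_of_sq_le hcs).trans ?_
  push_cast
  rw [Real.sqrt_mul (by positivity)]
  gcongr
  refine (Real.sqrt_le_sqrt hsum).trans_eq ?_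
  rw [Real.sqrt_mul (by positivity), Real.sqrt_sq hG]

lemma abs_increment_le (tree : DyadicTree d X D H) (hD : 0 ≤ D)
    (hpt : ∀ m ∈ Finset.Icc 1 H, ∀ j ∈ Jset d m, tree.pt m j ∈ tree.cell m j)
    {f : (Fin d → ℝ) → ℝ} {L α : ℝ} (hL : 0 < L) (hα : 0 < α)
    (hf : ∀ y ∈ X, ∀ y' ∈ X, |f y - f y'| ≤ L * ‖y - y'‖ ^ α)
    {m : ℕ} (hm : 1 ≤ m) (hmH : m < H) {j : Fin d → ℕ} (hj : j ∈ Jset d (m + 1)) :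
    |tree.increment f (m + 1) j| ≤ L * D ^ α * (2 : ℝ) ^ (-(m * α)) := by
  have hmem : ∀ n, 1 ≤ n → n ≤ H → ∀ i ∈ Jset d n, tree.pt n i ∈ X := fun n hn hnH i hi =>
    tree.cell_subset hn hnH i hi (hpt n (Finset.mem_Icc.2 ⟨hn, hnH⟩) i hi)
  rw [increment, if_neg (by omega), Nat.add_sub_cancel]
  refine (hf _ (hmem _ (by omega) hmH j hj) _
    (hmem _ hm hmH.le _ (half_mem_Jset hm hj))).trans ?_
  have hdist : ‖tree.pt (m + 1) j - tree.pt m fun i => j i / 2‖ ≤ (2 : ℝ) ^ (-(m : ℝ)) * D := by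
    refine (tree.parent_dist m hm hmH j hj).trans ?_
    gcongr
    · norm_num
    · linarith
  rw [mul_assoc]
  gcongr
  refine (Real.rpow_le_rpow (norm_nonneg _) hdist hα.le).trans_eq ?_
  rw [Real.mul_rpow (by positivity) hD, ← Real.rpow_mul (by norm_num)]
  ring_nf

end DyadicTree

lemma sum_pow_succ_le_of_one_lt {r : ℝ} (hr : 1 < r) (n : ℕ) :
    ∑ k ∈ Finset.range n, r ^ (k + 1) ≤ (r - 1)⁻¹ * r ^ (n + 1) := by
  have h := geom_sum_mul r n
  have hpos : 0 < r - 1 := by linarith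
  rw [inv_mul_eq_div, le_div_iff₀ hpos]
  simp_rw [pow_succ]
  rw [← Finset.sum_mul]
  nlinarith

lemma sum_pow_succ_le_of_lt_one {r : ℝ} (hr0 : 0 < r) (hr : r < 1) (n : ℕ) :
    ∑ k ∈ Finset.range n, r ^ (k + 1) ≤ (1 - r)⁻¹ := by
  have h := geom_sum_mul r n
  have hpos : 0 < 1 - r := by linarith
  have hpow : 0 < r ^ n := by positivity
  rw [inv_eq_one_div, le_div_iff₀ hpos]
  simp_rw [pow_succ]
  rw [← Finset.sum_mul]
  nlinarith

lemma sum_two_rpow_pow_succ_le {e : ℝ} (he : 1 / 2 ≤ e) (n : ℕ) :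
    ∑ k ∈ Finset.range n, ((2 : ℝ) ^ e) ^ (k + 1) ≤ 4 * ((2 : ℝ) ^ e) ^ (n + 1) := by
  have hlow : (5 / 4 : ℝ) ≤ 2 ^ e := by
    calc (5 / 4 : ℝ) ≤ √2 := Real.le_sqrt_of_sq_le (by norm_num)
      _ = 2 ^ (1 / 2 : ℝ) := Real.sqrt_eq_rpow 2
      _ ≤ 2 ^ e := Real.rpow_le_rpow_of_exponent_le (by norm_num) he
  refine (sum_pow_succ_le_of_one_lt (by linarith) n).trans ?_
  gcongr
  exact inv_le_of_inv_le₀ (by norm_num) (by linarith)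

/-- The sum of the level-wise bounds and of the approximation error is at most the stated rate. -/
lemma level_sum_le_rate {d n : ℕ} (hd : 1 ≤ d) {T : ℕ} (hT : T = 2 ^ (d * (n + 1)))
    {C₁ C₂ α : ℝ} (hC₁ : 0 < C₁) (hC₂ : 0 < C₂) :
    C₁ * √T * ∑ k ∈ Finset.range n, ((2 : ℝ) ^ ((d : ℝ) / 2 - α)) ^ (k + 1)
      + C₂ * ∑ k ∈ Finset.range n, ((2 : ℝ) ^ ((d : ℝ) - α)) ^ (k + 1)
      + ((2 : ℝ) ^ ((d : ℝ) - α)) ^ (n + 1)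
    ≤ if (d : ℝ) < 2 * α then
        (Phi ((d : ℝ) / 2 - α) * C₁ + 4 * C₂ + 1) * √T
      else if (d : ℝ) = 2 * α then
        (C₁ / d * Real.logb 2 T + 4 * C₂ + 1) * √T
      else
        (Phi ((d : ℝ) / 2 - α) * C₁ + 4 * C₂ + 1) * (T : ℝ) ^ (1 - α / (d : ℝ)) := by
  have hd' : (1 : ℝ) ≤ d := by exact_mod_cast hd
  have hTr : (T : ℝ) = 2 ^ ((d : ℝ) * (n + 1)) := by
    rw [hT]
    push_cast
    rw [← Real.rpow_natCast]
    push_cast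
    rfl
  have hsqrt : √(T : ℝ) = ((2 : ℝ) ^ ((d : ℝ) / 2)) ^ (n + 1) := by
    rw [hTr, Real.sqrt_eq_rpow, ← Real.rpow_natCast, ← Real.rpow_mul (by norm_num),
      ← Real.rpow_mul (by norm_num)]
    push_cast
    ring_nf
  have hsmall : (d : ℝ) ≤ 2 * α →
      C₂ * ∑ k ∈ Finset.range n, ((2 : ℝ) ^ ((d : ℝ) - α)) ^ (k + 1)
        + ((2 : ℝ) ^ ((d : ℝ) - α)) ^ (n + 1) ≤ (4 * C₂ + 1) * √T := by
    intro h
    have hq : (2 : ℝ) ^ ((d : ℝ) - α) ≤ 2 ^ ((d : ℝ) / 2) :=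
      Real.rpow_le_rpow_of_exponent_le (by norm_num) (by linarith)
    have h1 : ∑ k ∈ Finset.range n, ((2 : ℝ) ^ ((d : ℝ) - α)) ^ (k + 1) ≤ 4 * √T := by
      rw [hsqrt]
      refine le_trans ?_ (sum_two_rpow_pow_succ_le (by linarith) n)
      gcongr
    have h2 : ((2 : ℝ) ^ ((d : ℝ) - α)) ^ (n + 1) ≤ √T := by
      rw [hsqrt]
      gcongr
    nlinarith
  split_ifs with h1 h2
  · have hr : (2 : ℝ) ^ ((d : ℝ) / 2 - α) < 1 :=
      Real.rpow_lt_one_of_one_lt_of_neg (by norm_num) (by linarith)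
    have hPhi : Phi ((d : ℝ) / 2 - α) = (1 - (2 : ℝ) ^ ((d : ℝ) / 2 - α))⁻¹ := by
      rw [Phi, abs_of_neg (by linarith), neg_sub]
    have hs := mul_le_mul_of_nonneg_left
      (sum_pow_succ_le_of_lt_one (by positivity) hr n) (by positivity : 0 ≤ C₁ * √(T : ℝ))
    rw [← hPhi] at hs
    linarith [hsmall h1.le]
  · have hr : (2 : ℝ) ^ ((d : ℝ) / 2 - α) = 1 := by
      rw [show (d : ℝ) / 2 - α = 0 by linarith, Real.rpow_zero]
    have hlog : C₁ / d * Real.logb 2 T = C₁ * (n + 1) := by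
      rw [hTr, Real.logb_rpow (by norm_num) (by norm_num)]
      field_simp
    have hpos : 0 ≤ C₁ * √(T : ℝ) := by positivity
    rw [hr, hlog]
    simp only [one_pow, Finset.sum_const, Finset.card_range, nsmul_eq_mul, mul_one]
    linarith [hsmall h2.le]
  · have hlt : 2 * α < d := lt_of_le_of_ne (not_lt.1 h1) (Ne.symm h2)
    have hr : 1 < (2 : ℝ) ^ ((d : ℝ) / 2 - α) :=
      Real.one_lt_rpow (by norm_num) (by linarith)
    have hPhi : Phi ((d : ℝ) / 2 - α) = ((2 : ℝ) ^ ((d : ℝ) / 2 - α) - 1)⁻¹ := by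
      rw [Phi, abs_of_pos (by linarith)]
    have hrate : (T : ℝ) ^ (1 - α / (d : ℝ)) = ((2 : ℝ) ^ ((d : ℝ) - α)) ^ (n + 1) := by
      rw [hTr, ← Real.rpow_natCast, ← Real.rpow_mul (by norm_num), ← Real.rpow_mul (by norm_num)]
      congr 1
      push_cast
      field_simp
    have hprod : √(T : ℝ) * ((2 : ℝ) ^ ((d : ℝ) / 2 - α)) ^ (n + 1)
        = ((2 : ℝ) ^ ((d : ℝ) - α)) ^ (n + 1) := by
      rw [hsqrt, ← mul_pow, ← Real.rpow_add (by norm_num)]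
      ring_nf
    have hs := mul_le_mul_of_nonneg_left
      (sum_pow_succ_le_of_one_lt hr n) (by positivity : 0 ≤ C₁ * √(T : ℝ))
    rw [← hPhi] at hs
    have hq := mul_le_mul_of_nonneg_left
      (sum_two_rpow_pow_succ_le (e := (d : ℝ) - α) (by linarith) n) hC₂.le
    rw [hrate]
    have hs' : C₁ * √(T : ℝ) * (Phi ((d : ℝ) / 2 - α) * ((2 : ℝ) ^ ((d : ℝ) / 2 - α)) ^ (n + 1))
        = Phi ((d : ℝ) / 2 - α) * C₁ * ((2 : ℝ) ^ ((d : ℝ) - α)) ^ (n + 1) := by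
      rw [← hprod]
      ring
    linarith

/-- Minimax regret of the parameter-free chaining-tree algorithm over Hölder classes. -/
theorem stmt0
    (d H T : ℕ) (hd : 1 ≤ d) (hH : 1 ≤ H) (hT : T = 2 ^ (d * H))
    (X : Set (Fin d → ℝ)) (hX : X.Nonempty)
    (D G B C₁ C₂ : ℝ) (hD : 0 ≤ D) (hG : 0 < G) (hB : 0 < B)
    (hC₁ : 0 < C₁) (hC₂ : 0 < C₂)
    (tree : DyadicTree d X D H)
    (hpt : ∀ m ∈ Finset.Icc 1 H, ∀ j ∈ Jset d m, tree.pt m j ∈ tree.cell m j)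
    (x : ℕ → (Fin d → ℝ)) (hx : ∀ t, x t ∈ X)
    (ℓ : ℕ → ℝ → ℝ)
    (hconv : ∀ t, ConvexOn ℝ Set.univ (ℓ t))
    (hlip : ∀ t, ∀ y y' : ℝ, |ℓ t y - ℓ t y'| ≤ G * |y - y'|)
    (θ : ℕ → (Fin d → ℕ) → ℕ → ℝ)
    (hθinit : ∀ m j, θ m j 0 = 0)
    (fhat : ℕ → (Fin d → ℝ) → ℝ)
    (hfhat : ∀ t y, fhat t y = ∑ m ∈ Finset.Icc 1 H, ∑ j ∈ Jset d m,
      θ m j t * indR (tree.cell m j) y)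
    (g : ℕ → ℝ)
    (hgbound : ∀ t, |g t| ≤ G)
    (hgsub : ∀ t, ∀ y : ℝ, ℓ t (fhat t (x t)) + g t * (y - fhat t (x t)) ≤ ℓ t y)
    (hpf : ∀ m ∈ Finset.Icc 1 H, ∀ j ∈ Jset d m, ∀ θstar : ℝ,
      ∑ t ∈ Finset.range T, (g t * indR (tree.cell m j) (x t)) * (θ m j t - θstar)
        ≤ |θstar| * (C₁ * Real.sqrt (∑ t ∈ Finset.range T,
            (g t * indR (tree.cell m j) (x t)) ^ 2) + C₂ * G)) :
    ∀ L α : ℝ, 0 < L → 0 < α → α ≤ 1 →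
      ∀ f : (Fin d → ℝ) → ℝ,
        (∀ y ∈ X, ∀ y' ∈ X, |f y - f y'| ≤ L * ‖y - y'‖ ^ α) →
        (∀ y ∈ X, |f y| ≤ B) →
        ∑ t ∈ Finset.range T, ℓ t (fhat t (x t)) - ∑ t ∈ Finset.range T, ℓ t (f (x t))
          ≤ G * B * (C₁ * Real.sqrt T + C₂)
            + G * L * D ^ α *
              (if (d : ℝ) < 2 * α then
                 (Phi ((d : ℝ) / 2 - α) * C₁ + 4 * C₂ + 1) * Real.sqrt T
               else if (d : ℝ) = 2 * α then
                 (C₁ / d * Real.logb 2 T + 4 * C₂ + 1) * Real.sqrt T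
               else
                 (Phi ((d : ℝ) / 2 - α) * C₁ + 4 * C₂ + 1) * (T : ℝ) ^ (1 - α / (d : ℝ))) := by
  intro L α hL hα hα1 f hf hfB
  obtain ⟨n, rfl⟩ : ∃ n, H = n + 1 := ⟨H - 1, by omega⟩
  set S : ℕ → ℝ := fun t => ∑ m ∈ Finset.Icc 1 (n + 1), ∑ j ∈ Jset d m,
    tree.increment f m j * indR (tree.cell m j) (x t) with hS
  have happrox : ∀ t, |S t - f (x t)| ≤ L * D ^ α * ((2 : ℝ) ^ (-α)) ^ (n + 1) := by
    intro t
    obtain ⟨j, hj, hxj, hsum⟩ := tree.exists_sum_increment_eq f (hx t) hH le_rfl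
    have hmem : n + 1 ∈ Finset.Icc 1 (n + 1) := by simp
    have hptX := tree.cell_subset hH le_rfl j hj (hpt _ hmem j hj)
    simp only [hS]
    rw [hsum, abs_sub_comm, mul_assoc]
    refine (hf _ (hx t) _ hptX).trans ?_
    gcongr
    refine (Real.rpow_le_rpow (norm_nonneg _) (tree.pt_dist _ hmem j hj _ hxj) hα.le).trans_eq ?_
    rw [Real.mul_rpow (by positivity) hD, ← Real.rpow_natCast, ← Real.rpow_mul (by norm_num),
      ← Real.rpow_mul (by norm_num)]
    ring_nf
  have hround : ∀ t, ℓ t (fhat t (x t)) - ℓ t (f (x t))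
      ≤ g t * (fhat t (x t) - S t) + G * (L * D ^ α * ((2 : ℝ) ^ (-α)) ^ (n + 1)) := by
    intro t
    have h1 := hgsub t (S t)
    have h2 := (le_abs_self _).trans (hlip t (S t) (f (x t)))
    have h3 := mul_le_mul_of_nonneg_left (happrox t) hG.le
    linarith
  have hlinear : ∑ t ∈ Finset.range T, g t * (fhat t (x t) - S t)
      = ∑ m ∈ Finset.Icc 1 (n + 1), ∑ j ∈ Jset d m, ∑ t ∈ Finset.range T,
        (g t * indR (tree.cell m j) (x t)) * (θ m j t - tree.increment f m j) := by
    have hstep : ∀ t, g t * (fhat t (x t) - S t)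
        = ∑ m ∈ Finset.Icc 1 (n + 1), ∑ j ∈ Jset d m,
          (g t * indR (tree.cell m j) (x t)) * (θ m j t - tree.increment f m j) := by
      intro t
      simp only [hS, hfhat, ← Finset.sum_sub_distrib, Finset.mul_sum]
      refine Finset.sum_congr rfl fun m _ => Finset.sum_congr rfl fun j _ => ?_
      ring
    simp_rw [hstep]
    rw [Finset.sum_comm]
    exact Finset.sum_congr rfl fun m _ => Finset.sum_comm
  have hlevels : ∑ t ∈ Finset.range T, g t * (fhat t (x t) - S t)
      ≤ ∑ m ∈ Finset.Icc 1 (n + 1), ∑ j ∈ Jset d m, |tree.increment f m j| *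
        (C₁ * √(∑ t ∈ Finset.range T, (g t * indR (tree.cell m j) (x t)) ^ 2) + C₂ * G) := by
    rw [hlinear]
    exact Finset.sum_le_sum fun m hm => Finset.sum_le_sum fun j hj => hpf m hm j hj _
  have hlevel : ∀ m, 1 ≤ m → m ≤ n + 1 → ∀ b : ℝ, 0 ≤ b →
      (∀ j ∈ Jset d m, |tree.increment f m j| ≤ b) →
      ∑ j ∈ Jset d m, |tree.increment f m j| *
        (C₁ * √(∑ t ∈ Finset.range T, (g t * indR (tree.cell m j) (x t)) ^ 2) + C₂ * G)
      ≤ b * (C₁ * (√((2 : ℝ) ^ (d * (m - 1))) * (G * √T)) + C₂ * G * 2 ^ (d * (m - 1))) := by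
    intro m hm hmH b hb hle
    calc _ ≤ ∑ j ∈ Jset d m, b *
          (C₁ * √(∑ t ∈ Finset.range T, (g t * indR (tree.cell m j) (x t)) ^ 2) + C₂ * G) := by
          refine Finset.sum_le_sum fun j hj => ?_
          gcongr
          exact hle j hj
      _ = b * (C₁ * ∑ j ∈ Jset d m,
            √(∑ t ∈ Finset.range T, (g t * indR (tree.cell m j) (x t)) ^ 2)
            + C₂ * G * 2 ^ (d * (m - 1))) := by
          rw [← Finset.mul_sum, Finset.sum_add_distrib, ← Finset.mul_sum, Finset.sum_const,
            DyadicTree.card_Jset, nsmul_eq_mul]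
          push_cast
          ring
      _ ≤ _ := by
          gcongr
          exact tree.sum_sqrt_le hm hmH hx hG.le hgbound T
  have hroot := hlevel 1 le_rfl hH B hB.le (by
    intro j hj
    rw [DyadicTree.increment, if_pos rfl]
    exact hfB _ (tree.cell_subset le_rfl hH j hj (hpt 1 (by simp) j hj)))
  simp only [Nat.sub_self, mul_zero, pow_zero, Real.sqrt_one, one_mul, mul_one] at hroot
  have hdeep : ∀ k ∈ Finset.range n,
      ∑ j ∈ Jset d (k + 1 + 1), |tree.increment f (k + 1 + 1) j| *
        (C₁ * √(∑ t ∈ Finset.range T,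
          (g t * indR (tree.cell (k + 1 + 1) j) (x t)) ^ 2) + C₂ * G)
      ≤ G * L * D ^ α * (C₁ * √T * ((2 : ℝ) ^ ((d : ℝ) / 2 - α)) ^ (k + 1)
          + C₂ * ((2 : ℝ) ^ ((d : ℝ) - α)) ^ (k + 1)) := by
    intro k hk
    rw [Finset.mem_range] at hk
    refine (hlevel (k + 1 + 1) (by omega) (by omega)
      (L * D ^ α * (2 : ℝ) ^ (-((k + 1 : ℕ) * α))) (by positivity) fun j hj =>
        tree.abs_increment_le hD hpt hL hα hf (by omega) (by omega) hj).trans_eq ?_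
    have e0 : (2 : ℝ) ^ (-((k + 1 : ℕ) * α)) = ((2 : ℝ) ^ (-α)) ^ (k + 1) := by
      rw [← Real.rpow_natCast, ← Real.rpow_mul (by norm_num)]
      ring_nf
    have e1 : √((2 : ℝ) ^ (d * (k + 1))) = ((2 : ℝ) ^ ((d : ℝ) / 2)) ^ (k + 1) := by
      rw [Real.sqrt_eq_rpow, ← Real.rpow_natCast, ← Real.rpow_natCast,
        ← Real.rpow_mul (by norm_num), ← Real.rpow_mul (by norm_num)]
      push_cast
      ring_nf
    have e2 : (2 : ℝ) ^ ((d : ℝ) / 2 - α) = 2 ^ ((d : ℝ) / 2) * 2 ^ (-α) := by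
      rw [← Real.rpow_add (by norm_num), sub_eq_add_neg]
    have e3 : (2 : ℝ) ^ ((d : ℝ) - α) = 2 ^ d * 2 ^ (-α) := by
      rw [sub_eq_add_neg, Real.rpow_add (by norm_num), Real.rpow_natCast]
    rw [Nat.add_sub_cancel, e0, e1, e2, e3, pow_mul, mul_pow, mul_pow]
    ring
  have hsplit : ∀ F : ℕ → ℝ, ∑ m ∈ Finset.Icc 1 (n + 1), F m
      = ∑ k ∈ Finset.range n, F (k + 1 + 1) + F 1 := by
    intro F
    rw [← Finset.sum_range_succ' fun k => F (k + 1), Finset.range_eq_Ico, Finset.sum_Ico_add' F]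
    rfl
  rw [hsplit] at hlevels
  have hdeep' := Finset.sum_le_sum hdeep
  rw [← Finset.mul_sum, Finset.sum_add_distrib, ← Finset.mul_sum, ← Finset.mul_sum] at hdeep'
  have htotal : ∑ t ∈ Finset.range T, ℓ t (fhat t (x t)) - ∑ t ∈ Finset.range T, ℓ t (f (x t))
      ≤ ∑ t ∈ Finset.range T, g t * (fhat t (x t) - S t)
        + G * L * D ^ α * ((2 : ℝ) ^ ((d : ℝ) - α)) ^ (n + 1) := by
    rw [← Finset.sum_sub_distrib]
    refine (Finset.sum_le_sum fun t _ => hround t).trans_eq ?_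
    rw [Finset.sum_add_distrib, Finset.sum_const, Finset.card_range, nsmul_eq_mul, sub_eq_add_neg,
      Real.rpow_add (by norm_num), Real.rpow_natCast, mul_pow, ← pow_mul, hT]
    push_cast
    ring
  have hrate := mul_le_mul_of_nonneg_left (level_sum_le_rate (α := α) hd hT hC₁ hC₂)
    (by positivity : 0 ≤ G * L * D ^ α)
  linarith

end
end

section
/- Let 𝒳 be a set, 𝒳_1,…,𝒳_N ⊆ 𝒳, x_1,…,x_T ∈ 𝒳, and let ℓ_1,…,ℓ_T : ℝ → ℝ be convex. Suppose real parameters θ_{n,t} (1 ≤ n ≤ N, 1 ≤ t ≤ T) with initial values θ_{n,1} and targets θ_1,…,θ_N ∈ ℝ are given, and set f̂_t(x) = Σ_{n=1}^N θ_{n,t}·1{x ∈ 𝒳_n} and f̂*(x) = Σ_{n=1}^N θ_n·1{x ∈ 𝒳_n}. Let g_t be a subgradient of ℓ_t at f̂_t(x_t) with |g_t| ≤ G, and set g_{n,t} = g_t·1{x_t ∈ 𝒳_n}. If for every n it holds that Σ_{t=1}^T g_{n,t}(θ_{n,t} − θ_n) ≤ |θ_n − θ_{n,1}|·(C₁·√(Σ_{t=1}^T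 g_{n,t}²) + C₂·G) for constants C₁, C₂ > 0, then Σ_{t=1}^T ℓ_t(f̂_t(x_t)) − Σ_{t=1}^T ℓ_t(f̂*(x_t)) ≤ G·Σ_{n=1}^N |θ_n − θ_{n,1}|·(C₁·√|T_n| + C₂), where T_n = {1 ≤ t ≤ T : x_t ∈ 𝒳_n}. -/
open Finset
open scoped Classical

noncomputable section

/-- The energy of the gradients restricted to a set is at most `G ^ 2` times the number of
visits to that set. -/
theorem sqrt_sum_sq_mul_indR_le {X : Type*} (T : ℕ) (S : Set X) (x : ℕ → X) {G : ℝ}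
    (hG : 0 ≤ G) (g : ℕ → ℝ) (hg : ∀ t, |g t| ≤ G) :
    Real.sqrt (∑ t ∈ Finset.range T, (g t * indR S (x t)) ^ 2)
      ≤ G * Real.sqrt (((Finset.range T).filter (fun t => x t ∈ S)).card) := by
  have hsum : ∑ t ∈ Finset.range T, (g t * indR S (x t)) ^ 2
      ≤ G ^ 2 * (((Finset.range T).filter (fun t => x t ∈ S)).card : ℝ) := by
    rw [Finset.card_filter, Nat.cast_sum, Finset.mul_sum]
    refine Finset.sum_le_sum fun t _ => ?_
    by_cases h : x t ∈ S
    · simpa [indR, h] using sq_le_sq' (abs_le.mp (hg t)).1 (abs_le.mp (hg t)).2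
    · simp [indR, h]
  calc Real.sqrt (∑ t ∈ Finset.range T, (g t * indR S (x t)) ^ 2)
      ≤ Real.sqrt (G ^ 2 * (((Finset.range T).filter (fun t => x t ∈ S)).card : ℝ)) :=
        Real.sqrt_le_sqrt hsum
    _ = G * Real.sqrt (((Finset.range T).filter (fun t => x t ∈ S)).card) := by
        rw [Real.sqrt_mul (sq_nonneg G), Real.sqrt_sq hG]

/-- Estimation-error bound: convexity of the losses reduces the regret against a fixed
parameter vector to linearized per-node regrets controlled by the parameter-free
grad-step bound. -/
theorem stmt3 {X : Type*}
    (N T : ℕ) (Xs : ℕ → Set X) (x : ℕ → X)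
    (G C₁ C₂ : ℝ) (hG : 0 < G) (hC₁ : 0 < C₁) (hC₂ : 0 < C₂)
    (ℓ : ℕ → ℝ → ℝ)
    (hconv : ∀ t, ConvexOn ℝ Set.univ (ℓ t))
    (θ : ℕ → ℕ → ℝ)            -- θ n t : parameter of node n at time t (t = 0 initial)
    (θstar : ℕ → ℝ)            -- target parameters
    (fhat : ℕ → X → ℝ)
    (hfhat : ∀ t y, fhat t y = ∑ n ∈ Finset.range N, θ n t * indR (Xs n) y)
    (fstar : X → ℝ)
    (hfstar : ∀ y, fstar y = ∑ n ∈ Finset.range N, θstar n * indR (Xs n) y)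
    (g : ℕ → ℝ)
    (hgbound : ∀ t, |g t| ≤ G)
    (hgsub : ∀ t, ∀ y : ℝ, ℓ t (fhat t (x t)) + g t * (y - fhat t (x t)) ≤ ℓ t y)
    (hpf : ∀ n ∈ Finset.range N,
      ∑ t ∈ Finset.range T, (g t * indR (Xs n) (x t)) * (θ n t - θstar n)
        ≤ |θstar n - θ n 0| * (C₁ * Real.sqrt (∑ t ∈ Finset.range T,
            (g t * indR (Xs n) (x t)) ^ 2) + C₂ * G)) :
    ∑ t ∈ Finset.range T, ℓ t (fhat t (x t)) - ∑ t ∈ Finset.range T, ℓ t (fstar (x t))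
      ≤ G * ∑ n ∈ Finset.range N, |θstar n - θ n 0| *
          (C₁ * Real.sqrt (((Finset.range T).filter (fun t => x t ∈ Xs n)).card) + C₂) := by
  calc ∑ t ∈ Finset.range T, ℓ t (fhat t (x t)) - ∑ t ∈ Finset.range T, ℓ t (fstar (x t))
      = ∑ t ∈ Finset.range T, (ℓ t (fhat t (x t)) - ℓ t (fstar (x t))) :=
        (Finset.sum_sub_distrib _ _).symm
    _ ≤ ∑ t ∈ Finset.range T, g t * (fhat t (x t) - fstar (x t)) :=
        Finset.sum_le_sum fun t _ => by linarith [hgsub t (fstar (x t))]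
    _ = ∑ n ∈ Finset.range N, ∑ t ∈ Finset.range T,
          (g t * indR (Xs n) (x t)) * (θ n t - θstar n) := by
        rw [Finset.sum_comm]
        refine Finset.sum_congr rfl fun t _ => ?_
        rw [hfhat, hfstar, ← Finset.sum_sub_distrib, Finset.mul_sum]
        exact Finset.sum_congr rfl fun n _ => by ring
    _ ≤ ∑ n ∈ Finset.range N, |θstar n - θ n 0| * (C₁ * (G *
          Real.sqrt (((Finset.range T).filter (fun t => x t ∈ Xs n)).card)) + C₂ * G) := by
        refine Finset.sum_le_sum fun n hn => (hpf n hn).trans ?_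
        gcongr
        exact sqrt_sum_sq_mul_indR_le T (Xs n) x hG.le g hgbound
    _ = G * ∑ n ∈ Finset.range N, |θstar n - θ n 0| *
          (C₁ * Real.sqrt (((Finset.range T).filter (fun t => x t ∈ Xs n)).card) + C₂) := by
        rw [Finset.mul_sum]
        exact Finset.sum_congr rfl fun n _ => by ring

end
end

section
/- Let N, T ≥ 1, let θ_1,…,θ_N ∈ ℝ, let g_{n,t} ∈ ℝ for 1 ≤ n ≤ N and 1 ≤ t ≤ T, and let q ∈ [2, ∞) with p = q/(q−1). Then Σ_{n=1}^N |θ_n|·√(Σ_{t=1}^T g_{n,t}²) ≤ (Σ_{n=1}^N |θ_n|^p)^{1/p} · √( Σ_{t=1}^T (Σ_{n=1}^N |g_{n,t}|^q)^{2/q} ). -/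
open Finset

noncomputable section

/-- **Minkowski inequality** for finite sums of nonnegative functions. -/
theorem Lp_sum_le_of_nonneg {ι κ : Type*} (s : Finset ι) (u : Finset κ) (f : ι → κ → ℝ)
    (hf : ∀ i j, 0 ≤ f i j) {r : ℝ} (hr : 1 ≤ r) :
    (∑ i ∈ s, (∑ j ∈ u, f i j) ^ r) ^ (1 / r) ≤ ∑ j ∈ u, (∑ i ∈ s, f i j ^ r) ^ (1 / r) := by
  classical
  have hr0 : r ≠ 0 := by positivity
  induction u using Finset.induction_on with
  | empty => simp [hr0]
  | insert a u ha ih =>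
    simp only [sum_insert ha]
    exact (Real.Lp_add_le_of_nonneg s hr (fun i _ => hf i a)
      fun i _ => sum_nonneg fun j _ => hf i j).trans (add_le_add_right ih _)

/-- Node-wise adaptive bound vs. global mirror-descent bound: Hölder plus Minkowski. -/
theorem stmt5
    (N T : ℕ) (hN : 1 ≤ N) (hT : 1 ≤ T)
    (θ : ℕ → ℝ) (g : ℕ → ℕ → ℝ)
    (q p : ℝ) (hq : 2 ≤ q) (hp : p = q / (q - 1)) :
    ∑ n ∈ Finset.range N, |θ n| * Real.sqrt (∑ t ∈ Finset.range T, g n t ^ 2)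
      ≤ (∑ n ∈ Finset.range N, |θ n| ^ p) ^ (1 / p) *
        Real.sqrt (∑ t ∈ Finset.range T, (∑ n ∈ Finset.range N, |g n t| ^ q) ^ (2 / q)) := by
  have hpq : p.HolderConjugate q := by
    rw [hp]
    exact (Real.HolderConjugate.conjExponent (by linarith)).symm
  have hq0 : q ≠ 0 := by positivity
  refine (Real.inner_le_Lp_mul_Lq_of_nonneg _ hpq (fun n _ => abs_nonneg (θ n))
    fun n _ => Real.sqrt_nonneg _).trans ?_
  gcongr
  have hsqrt (n : ℕ) :
      Real.sqrt (∑ t ∈ range T, g n t ^ 2) ^ q = (∑ t ∈ range T, g n t ^ 2) ^ (q / 2) := by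
    rw [Real.sqrt_eq_rpow, ← Real.rpow_mul (sum_nonneg fun t _ => sq_nonneg _)]
    ring_nf
  have habs (n t : ℕ) : |g n t| ^ q = (g n t ^ 2) ^ (q / 2) := by
    rw [← sq_abs, ← Real.rpow_natCast, ← Real.rpow_mul (abs_nonneg _)]
    congr 1
    push_cast
    ring
  simp only [hsqrt, habs]
  apply Real.le_sqrt_of_sq_le
  rw [← Real.rpow_natCast, ← Real.rpow_mul (by positivity)]
  convert Lp_sum_le_of_nonneg (range N) (range T) (fun n t => g n t ^ 2)
    (fun n t => sq_nonneg _) (r := q / 2) (by linarith) using 2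
  · push_cast
    field_simp
  · field_simp

end
end

section
/- In the sleeping-experts setting, let ℓ : ℝ → ℝ be convex and let c be a subgradient of ℓ at ŷ. Then for every i ∈ I, (ℓ(ŷ) − ℓ(p_i))·1{i ∈ A} ≤ Σ_{j∈I} g̃_j·w_j − g̃_i. -/
open Finset

noncomputable section

/-- Sleeping-experts linearization: for a convex loss with subgradient `c` at the
aggregated prediction `ŷ`, the instantaneous regret of any awake expert is bounded by
its linearized sleeping regret. -/
theorem stmt9 {ι : Type*} [Fintype ι] [DecidableEq ι]
    (A : Finset ι) (wt : ι → ℝ)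
    (hwnn : ∀ i, 0 ≤ wt i) (hwsum : ∑ i, wt i = 1)
    (hA : 0 < ∑ i ∈ A, wt i)
    (p : ι → ℝ)
    (w : ι → ℝ)
    (hw : ∀ i, w i = if i ∈ A then wt i / ∑ j ∈ A, wt j else 0)
    (yhat : ℝ) (hy : yhat = ∑ i ∈ A, w i * p i)
    (ℓ : ℝ → ℝ) (hconv : ConvexOn ℝ Set.univ ℓ)
    (c : ℝ) (hsub : ∀ y : ℝ, ℓ yhat + c * (y - yhat) ≤ ℓ y)
    (gt : ι → ℝ)
    (hgt : ∀ i, gt i = if i ∈ A then c * p i else c * yhat) :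
    ∀ i, (ℓ yhat - ℓ (p i)) * (if i ∈ A then (1 : ℝ) else 0)
        ≤ (∑ j, gt j * w j) - gt i := by
  have hsum : ∑ j, gt j * w j = c * yhat := by
    rw [hy, mul_sum, ← sum_subset (subset_univ A)]
    · refine sum_congr rfl fun j hj => ?_
      rw [hgt j, if_pos hj]
      ring
    · intro j _ hj
      rw [hw j, if_neg hj, mul_zero]
  intro i
  rw [hsum, hgt i]
  split_ifs with hi
  · linarith [hsub (p i)]
  · simp

end
end
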